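/- Fix an integer e ≥ 2 and κ = (κ₁, κ₂) ∈ (ℤ/eℤ)². Suppose λ is a bipartition with wt(λ) = 3. Then for every i ∈ ℤ/eℤ, the number of removable i-nodes of λ is at most max{1, δ_i(λ) + 1}. -/

import Mathlib

namespace Wt3

/-- `f : ℕ → ℕ` (0-indexed: `f r` is the `(r+1)`-th part `λ_{r+1}`) is a partition if it is
weakly decreasing with finitely many nonzero terms. -/
def IsPartition (f : ℕ → ℕ) : Prop :=
  (∀ r, f (r + 1) ≤ f r) ∧ ∃ N, ∀ r, N ≤ r → f r = 0

/-- A bipartition: an ordered pair of partitions, given as `lam : Fin 2 → ℕ → ℕ`. -/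
def IsBipartition (lam : Fin 2 → ℕ → ℕ) : Prop := ∀ a, IsPartition (lam a)

/-- Nodes `(r, c, a)` with 0-indexed row `r`, column `c`, and component `a : Fin 2`. -/
abbrev Node := ℕ × ℕ × Fin 2

/-- The Young diagram of a bipartition: `(r,c,a)` is a node iff `c < λ⁽ᵃ⁾_r` (0-indexed,
corresponding to `c+1 ≤ λ⁽ᵃ⁾_{r+1}` in 1-indexed terms). -/
def Diagram (lam : Fin 2 → ℕ → ℕ) : Set Node := {x | x.2.1 < lam x.2.2 x.1}

/-- A node of `[λ]` is removable if deleting it leaves the Young diagram of a bipartition. -/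
def IsRemovable (lam : Fin 2 → ℕ → ℕ) (x : Node) : Prop :=
  x ∈ Diagram lam ∧ ∃ mu, IsBipartition mu ∧ Diagram mu = Diagram lam \ {x}

/-- A node not in `[λ]` is addable if adding it gives the Young diagram of a bipartition. -/
def IsAddable (lam : Fin 2 → ℕ → ℕ) (x : Node) : Prop :=
  x ∉ Diagram lam ∧ ∃ mu, IsBipartition mu ∧ Diagram mu = Diagram lam ∪ {x}

/-- The residue `c − r + κ_a ∈ ℤ/eℤ` of a node `(r,c,a)` (0-indexing leaves this unchanged). -/
def res (e : ℕ) (κ : Fin 2 → ZMod e) (x : Node) : ZMod e :=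
  (x.2.1 : ZMod e) - (x.1 : ZMod e) + κ x.2.2

/-- `c_i(λ)`: the number of `i`-nodes of `λ`. -/
noncomputable def cnt (e : ℕ) (κ : Fin 2 → ZMod e) (lam : Fin 2 → ℕ → ℕ) (i : ZMod e) : ℕ :=
  Set.ncard {x : Node | x ∈ Diagram lam ∧ res e κ x = i}

/-- The number of removable `i`-nodes of `λ`. -/
noncomputable def remCount (e : ℕ) (κ : Fin 2 → ZMod e) (lam : Fin 2 → ℕ → ℕ) (i : ZMod e) : ℕ :=
  Set.ncard {x : Node | IsRemovable lam x ∧ res e κ x = i}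

/-- The number of addable `i`-nodes of `λ`. -/
noncomputable def addCount (e : ℕ) (κ : Fin 2 → ZMod e) (lam : Fin 2 → ℕ → ℕ) (i : ZMod e) : ℕ :=
  Set.ncard {x : Node | IsAddable lam x ∧ res e κ x = i}

/-- `δ_i(λ)`: number of removable `i`-nodes minus number of addable `i`-nodes. -/
noncomputable def delta (e : ℕ) (κ : Fin 2 → ZMod e) (lam : Fin 2 → ℕ → ℕ) (i : ZMod e) : ℤ :=
  (remCount e κ lam i : ℤ) - (addCount e κ lam i : ℤ)

/-- The weight `wt(λ) = c_{κ₁}(λ) + c_{κ₂}(λ) − ½ Σ_{i ∈ ℤ/eℤ} (c_i(λ) − c_{i+1}(λ))²`. -/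
noncomputable def wt (e : ℕ) (κ : Fin 2 → ZMod e) (lam : Fin 2 → ℕ → ℕ) : ℚ :=
  (cnt e κ lam (κ 0) : ℚ) + (cnt e κ lam (κ 1) : ℚ) -
    (1 / 2) * ∑ j ∈ Finset.range e,
      ((cnt e κ lam (j : ZMod e) : ℚ) - (cnt e κ lam ((j : ZMod e) + 1) : ℚ)) ^ 2

/-- The rim of `λ`: nodes `(r,c,a) ∈ [λ]` with `(r+1,c+1,a) ∉ [λ]`. -/
def Rim (lam : Fin 2 → ℕ → ℕ) : Set Node :=
  {x | x ∈ Diagram lam ∧ (x.1 + 1, x.2.1 + 1, x.2.2) ∉ Diagram lam}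

/-- One step along a strip: `y` is one step to the right of, or one step above, `x`
(in the same component). -/
def Step (x y : Node) : Prop :=
  y.2.2 = x.2.2 ∧ ((y.1 = x.1 ∧ y.2.1 = x.2.1 + 1) ∨ (x.1 = y.1 + 1 ∧ y.2.1 = x.2.1))

/-- A rim hook of `λ`: a nonempty subset of the rim, contained in a single component,
forming a connected strip, whose removal leaves the Young diagram of a bipartition. -/
def IsRimHook (lam : Fin 2 → ℕ → ℕ) (H : Finset Node) : Prop :=
  H.Nonempty ∧ ↑H ⊆ Rim lam ∧ (∀ x ∈ H, ∀ y ∈ H, x.2.2 = y.2.2) ∧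
    (∃ l : List Node, l.Chain' Step ∧ ∀ x : Node, x ∈ l ↔ x ∈ H) ∧
    ∃ mu, IsBipartition mu ∧ Diagram mu = Diagram lam \ ↑H

/-- A bicore: a bipartition with no rim `e`-hooks. -/
def IsBicore (e : ℕ) (lam : Fin 2 → ℕ → ℕ) : Prop :=
  ¬ ∃ H : Finset Node, IsRimHook lam H ∧ H.card = e

/-- The beta-set `{λ_r + k − r : 1 ≤ r ≤ k}` of a partition with charge `k` (0-indexed form). -/
def betaSet (f : ℕ → ℕ) (k : ℕ) : Finset ℕ :=
  (Finset.range k).image fun r => f r + (k - (r + 1))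

/-- The number of nonzero parts of a partition. -/
noncomputable def len (f : ℕ → ℕ) : ℕ := Set.ncard {r : ℕ | f r ≠ 0}

/-- `(k₁,k₂)` is a bicharge for `κ` relative to `λ`. -/
def IsBicharge (e : ℕ) (κ : Fin 2 → ZMod e) (lam : Fin 2 → ℕ → ℕ) (k₁ k₂ : ℕ) : Prop :=
  (k₁ : ZMod e) = κ 0 ∧ (k₂ : ZMod e) = κ 1 ∧ len (lam 0) ≤ k₁ ∧ len (lam 1) ≤ k₂

/-- `γ_x(λ)`: beads of residue `x` in the first beta-set minus those in the second. -/
def gamma (e : ℕ) (lam : Fin 2 → ℕ → ℕ) (k₁ k₂ : ℕ) (x : ZMod e) : ℤ :=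
  (((betaSet (lam 0) k₁).filter fun b : ℕ => (b : ZMod e) = x).card : ℤ) -
    (((betaSet (lam 1) k₂).filter fun b : ℕ => (b : ZMod e) = x).card : ℤ)

/-- `x` is above (higher than) `y`. -/
def Above (x y : Node) : Prop := x.2.2 < y.2.2 ∨ (x.2.2 = y.2.2 ∧ x.1 < y.1)

/-- A normal `i`-node: a removable `i`-node `x` such that for every addable `i`-node `y`
below `x`, the removable `i`-nodes strictly between `x` and `y` outnumber the addable ones
(equivalently, the `−` sign of `x` survives in the reduced `i`-signature). -/
def IsNormal (e : ℕ) (κ : Fin 2 → ZMod e) (lam : Fin 2 → ℕ → ℕ) (i : ZMod e) (x : Node) :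
    Prop :=
  IsRemovable lam x ∧ res e κ x = i ∧
    ∀ y : Node, IsAddable lam y → res e κ y = i → Above x y →
      Set.ncard {z : Node | IsAddable lam z ∧ res e κ z = i ∧ Above x z ∧ Above z y} <
        Set.ncard {z : Node | IsRemovable lam z ∧ res e κ z = i ∧ Above x z ∧ Above z y}

/-- The good `i`-node: the highest normal `i`-node. -/
def IsGood (e : ℕ) (κ : Fin 2 → ZMod e) (lam : Fin 2 → ℕ → ℕ) (i : ZMod e) (x : Node) :
    Prop :=
  IsNormal e κ lam i x ∧ ∀ y, IsNormal e κ lam i y → y = x ∨ Above x y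

/-- An antinormal `i`-node: a removable `i`-node `x` such that for every addable `i`-node `y`
above `x`, the removable `i`-nodes strictly between `y` and `x` outnumber the addable ones
(equivalently, the `−` sign of `x` survives in the antireduced `i`-signature). -/
def IsAntinormal (e : ℕ) (κ : Fin 2 → ZMod e) (lam : Fin 2 → ℕ → ℕ) (i : ZMod e) (x : Node) :
    Prop :=
  IsRemovable lam x ∧ res e κ x = i ∧
    ∀ y : Node, IsAddable lam y → res e κ y = i → Above y x →
      Set.ncard {z : Node | IsAddable lam z ∧ res e κ z = i ∧ Above y z ∧ Above z x} <
        Set.ncard {z : Node | IsRemovable lam z ∧ res e κ z = i ∧ Above y z ∧ Above z x}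

/-- The antigood `i`-node: the lowest antinormal `i`-node. -/
def IsAntigood (e : ℕ) (κ : Fin 2 → ZMod e) (lam : Fin 2 → ℕ → ℕ) (i : ZMod e) (x : Node) :
    Prop :=
  IsAntinormal e κ lam i x ∧ ∀ y, IsAntinormal e κ lam i y → y = x ∨ Above y x

/-- `μ →ᵢ λ`: `μ` is obtained from `λ` by removing the good `i`-node. -/
def RemGoodAt (e : ℕ) (κ : Fin 2 → ZMod e) (i : ZMod e) (mu lam : Fin 2 → ℕ → ℕ) : Prop :=
  ∃ x, IsGood e κ lam i x ∧ Diagram mu = Diagram lam \ {x}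

/-- `μ ⇒ᵢ λ`: `μ` is obtained from `λ` by removing the antigood `i`-node. -/
def RemAntigoodAt (e : ℕ) (κ : Fin 2 → ZMod e) (i : ZMod e) (mu lam : Fin 2 → ℕ → ℕ) : Prop :=
  ∃ x, IsAntigood e κ lam i x ∧ Diagram mu = Diagram lam \ {x}

/-- `μ → λ`: `μ` is obtained from the bipartition `λ` by removing a good node. -/
def RemGood (e : ℕ) (κ : Fin 2 → ZMod e) (mu lam : Fin 2 → ℕ → ℕ) : Prop :=
  IsBipartition mu ∧ IsBipartition lam ∧ ∃ i, RemGoodAt e κ i mu lam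

/-- A bipartition is restricted if it lies in the class of the empty bipartition under the
equivalence relation generated by `→`. -/
def IsRestricted (e : ℕ) (κ : Fin 2 → ZMod e) (lam : Fin 2 → ℕ → ℕ) : Prop :=
  Relation.EqvGen (RemGood e κ) lam (fun _ _ => 0)

/-- A partition is `e`-restricted if `λ_r − λ_{r+1} < e` for all `r`. -/
def IsERestricted (e : ℕ) (f : ℕ → ℕ) : Prop := ∀ r, f r < f (r + 1) + e

/-- The conjugate partition: `λ′_r = #{c : λ_c ≥ r}` (0-indexed form). -/
noncomputable def conjP (f : ℕ → ℕ) : ℕ → ℕ := fun r => Set.ncard {c : ℕ | r + 1 ≤ f c}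

/-- The conjugate bipartition `λ′ = ((λ⁽²⁾)′ | (λ⁽¹⁾)′)`. -/
noncomputable def conjB (lam : Fin 2 → ℕ → ℕ) : Fin 2 → ℕ → ℕ := fun a => conjP (lam (1 - a))

/-- `|λ|` for a partition. -/
noncomputable def psize (f : ℕ → ℕ) : ℕ := Set.ncard {p : ℕ × ℕ | p.2 < f p.1}

/-- `|λ|` for a bipartition. -/
noncomputable def bsize (lam : Fin 2 → ℕ → ℕ) : ℕ := psize (lam 0) + psize (lam 1)

/-- `λ_1 + ⋯ + λ_r`. -/
def psum (f : ℕ → ℕ) (r : ℕ) : ℕ := ∑ j ∈ Finset.range r, f j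

/-- The dominance order on bipartitions: `λ ⊵ μ`. -/
def Dominates (lam mu : Fin 2 → ℕ → ℕ) : Prop :=
  ∀ r : ℕ, psum (mu 0) r ≤ psum (lam 0) r ∧
    psize (mu 0) + psum (mu 1) r ≤ psize (lam 0) + psum (lam 1) r

/-! Single-partition versions (for statement 11). -/

abbrev Node1 := ℕ × ℕ

def Diagram1 (f : ℕ → ℕ) : Set Node1 := {x | x.2 < f x.1}

def IsRemovable1 (f : ℕ → ℕ) (x : Node1) : Prop :=
  x ∈ Diagram1 f ∧ ∃ g, IsPartition g ∧ Diagram1 g = Diagram1 f \ {x}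

def IsAddable1 (f : ℕ → ℕ) (x : Node1) : Prop :=
  x ∉ Diagram1 f ∧ ∃ g, IsPartition g ∧ Diagram1 g = Diagram1 f ∪ {x}

def res1 (e : ℕ) (k : ZMod e) (x : Node1) : ZMod e := (x.2 : ZMod e) - (x.1 : ZMod e) + k

def Rim1 (f : ℕ → ℕ) : Set Node1 := {x | x ∈ Diagram1 f ∧ (x.1 + 1, x.2 + 1) ∉ Diagram1 f}

def Step1 (x y : Node1) : Prop :=
  (y.1 = x.1 ∧ y.2 = x.2 + 1) ∨ (x.1 = y.1 + 1 ∧ y.2 = x.2)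

def IsRimHook1 (f : ℕ → ℕ) (H : Finset Node1) : Prop :=
  H.Nonempty ∧ ↑H ⊆ Rim1 f ∧
    (∃ l : List Node1, l.Chain' Step1 ∧ ∀ x : Node1, x ∈ l ↔ x ∈ H) ∧
    ∃ g, IsPartition g ∧ Diagram1 g = Diagram1 f \ ↑H

/-- An `e`-core: a partition with no rim `e`-hooks. -/
def IsECore (e : ℕ) (f : ℕ → ℕ) : Prop := ¬ ∃ H : Finset Node1, IsRimHook1 f H ∧ H.card = e

/-! The statement. -/

theorem IsPartition.antitone {f : ℕ → ℕ} (hf : IsPartition f) : Antitone f :=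
  antitone_nat_of_succ_le hf.1

theorem isRemovable_iff {lam : Fin 2 → ℕ → ℕ} (hlam : IsBipartition lam) (r c : ℕ) (a : Fin 2) :
    IsRemovable lam (r, c, a) ↔ c + 1 = lam a r ∧ lam a (r + 1) < lam a r := by
  constructor
  · rintro ⟨hx, mu, hmu, h⟩
    have key : ∀ r' c' : ℕ, c' < mu a r' ↔ c' < lam a r' ∧ ¬ (r' = r ∧ c' = c) := by
      intro r' c'
      have := Set.ext_iff.1 h (r', c', a)
      simpa [Diagram] using this
    have hx' : c < lam a r := hx
    have h1 := key r c
    have h2 := key r (c + 1)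
    have h3 := key (r + 1) c
    have h4 := (hmu a).1 r
    simp only [and_self, not_true_eq_false, and_false, iff_false] at h1
    simp only [Nat.succ_ne_self, and_false, not_false_eq_true, and_true] at h2
    simp only [Nat.succ_ne_self, not_false_eq_true, and_true] at h3
    omega
  · rintro ⟨h1, h2⟩
    refine ⟨show c < lam a r by omega, Function.update lam a (Function.update (lam a) r c), ?_, ?_⟩
    · intro b
      by_cases hb : b = a
      · subst hb
        obtain ⟨hd, N, hN⟩ := hlam b
        simp only [Function.update_self]
        refine ⟨fun r' => ?_, N, fun r' hr' => ?_⟩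
        · have := hd r'
          simp only [Function.update_apply]
          split_ifs with h3 h4 h4 <;> subst_vars <;> omega
        · have := hN r' hr'
          simp only [Function.update_apply]
          split_ifs with h3 <;> subst_vars <;> omega
      · simpa [Function.update_of_ne hb] using hlam b
    · ext ⟨r', c', b⟩
      simp only [Diagram, Set.mem_ofPred_eq, Set.mem_sdiff, Set.mem_singleton_iff, Prod.mk.injEq,
        Function.update_apply]
      by_cases hb : b = a
      · subst hb
        by_cases hr : r' = r
        · subst hr; simp; omega
        · simp [hr]
      · simp [hb]

theorem isAddable_iff {lam : Fin 2 → ℕ → ℕ} (hlam : IsBipartition lam) (r c : ℕ) (a : Fin 2) :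
    IsAddable lam (r, c, a) ↔ c = lam a r ∧ (r = 0 ∨ lam a r < lam a (r - 1)) := by
  constructor
  · rintro ⟨hx, mu, hmu, h⟩
    have key : ∀ r' c' : ℕ, c' < mu a r' ↔ c' < lam a r' ∨ (r' = r ∧ c' = c) := by
      intro r' c'
      have := Set.ext_iff.1 h (r', c', a)
      simpa [Diagram, or_comm] using this
    have hx' : ¬ c < lam a r := hx
    have h1 := key r c
    have h2 := key r (c - 1)
    simp only [and_self, or_true, iff_true] at h1
    have hc : c = lam a r := by omega
    refine ⟨hc, ?_⟩
    rcases r with _ | r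
    · simp
    · right
      have h3 := key r c
      have h4 := (hmu a).1 r
      simp only [Nat.add_sub_cancel]
      omega
  · rintro ⟨rfl, h2⟩
    refine ⟨show ¬ lam a r < lam a r by omega,
      Function.update lam a (Function.update (lam a) r (lam a r + 1)), ?_, ?_⟩
    · intro b
      by_cases hb : b = a
      · subst hb
        obtain ⟨hd, N, hN⟩ := hlam b
        simp only [Function.update_self]
        refine ⟨fun r' => ?_, max N (r + 1), fun r' hr' => ?_⟩
        · have := hd r'
          simp only [Function.update_apply]
          split_ifs with h3 h4 h4
          · omega
          · subst h3
            simp only [Nat.add_sub_cancel] at h2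
            omega
          · subst h4; omega
          · omega
        · have h3 := hN r' (by omega)
          rw [Function.update_of_ne (by omega), h3]
      · simpa [Function.update_of_ne hb] using hlam b
    · ext ⟨r', c', b⟩
      simp only [Diagram, Set.mem_ofPred_eq, Set.mem_union, Set.mem_singleton_iff, Prod.mk.injEq,
        Function.update_apply]
      by_cases hb : b = a
      · subst hb
        by_cases hr : r' = r
        · subst hr; simp; omega
        · simp [hr]
      · simp [hb]

/-- A common bound for the number of parts and the parts of a bipartition. -/
theorem IsBipartition.exists_bound {lam : Fin 2 → ℕ → ℕ} (hlam : IsBipartition lam) :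
    ∃ N, ∀ a r, lam a r ≤ N ∧ (N ≤ r → lam a r = 0) := by
  obtain ⟨M, hM⟩ := (hlam 0).2
  obtain ⟨M', hM'⟩ := (hlam 1).2
  refine ⟨M + M' + lam 0 0 + lam 1 0, fun a r => ?_⟩
  have h0 := (hlam 0).antitone (Nat.zero_le r)
  have h1 := (hlam 1).antitone (Nat.zero_le r)
  fin_cases a
  · exact ⟨by simp only [Fin.zero_eta]; omega, fun h => hM r (by omega)⟩
  · exact ⟨by simp only [Fin.mk_one]; omega, fun h => hM' r (by omega)⟩

open Classical in
/-- A set of nodes inside a box is counted component by component and row by row. -/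
theorem ncard_eq_sum (p : Node → Prop) (K : ℕ) (hp : ∀ x, p x → x.1 < K ∧ x.2.1 < K) :
    (Set.ncard {x : Node | p x} : ℤ) =
      ∑ a : Fin 2, ∑ r ∈ Finset.range K, ∑ c ∈ Finset.range K, if p (r, c, a) then 1 else 0 := by
  have h : {x : Node | p x} =
      ↑((Finset.range K ×ˢ Finset.range K ×ˢ (Finset.univ : Finset (Fin 2))).filter p) := by
    ext x
    simp only [Set.mem_ofPred_eq, Finset.coe_filter, Finset.mem_product, Finset.mem_range,
      Finset.mem_univ, and_true]
    exact ⟨fun h => ⟨hp x h, h⟩, fun h => h.2⟩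
  rw [h, Set.ncard_coe_finset, Finset.card_filter]
  push_cast
  rw [Finset.sum_product, Finset.sum_comm' (t' := Finset.range K) (s' := fun _ => Finset.univ)
    (by simp)]
  refine Finset.sum_congr rfl fun r _ => ?_
  rw [Finset.sum_product, Finset.sum_comm]

theorem finite_diagram {lam : Fin 2 → ℕ → ℕ} (hlam : IsBipartition lam) :
    (Diagram lam).Finite := by
  obtain ⟨N, hN⟩ := hlam.exists_bound
  refine (Finset.range N ×ˢ Finset.range N ×ˢ (Finset.univ : Finset (Fin 2))).finite_toSet.subset ?_
  rintro ⟨r, c, a⟩ hx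
  have hx' : c < lam a r := hx
  have h := hN a r
  simp only [Finset.coe_product, Set.mem_prod, Finset.mem_coe, Finset.mem_range, Finset.mem_univ,
    and_true]
  omega

section Counting

variable {e : ℕ} {κ : Fin 2 → ZMod e} {lam : Fin 2 → ℕ → ℕ} {N : ℕ}

theorem cnt_eq_sum (hN : ∀ a r, lam a r ≤ N ∧ (N ≤ r → lam a r = 0)) (i : ZMod e) :
    (cnt e κ lam i : ℤ) = ∑ a : Fin 2, ∑ r ∈ Finset.range N, ∑ c ∈ Finset.range (lam a r),
      if (c : ZMod e) - r + κ a = i then 1 else 0 := by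
  classical
  rw [cnt, ncard_eq_sum _ N]
  · refine Finset.sum_congr rfl fun a _ => Finset.sum_congr rfl fun r _ => ?_
    rw [← Finset.sum_subset (Finset.range_subset_range.2 (hN a r).1)]
    · refine Finset.sum_congr rfl fun c hc => ?_
      simp [Diagram, res, Finset.mem_range.1 hc]
    · intro c _ hc
      simp only [Finset.mem_range] at hc
      simp [Diagram, hc]
  · rintro ⟨r, c, a⟩ ⟨hx, -⟩
    have hx' : c < lam a r := hx
    have h := hN a r
    dsimp only
    omega

theorem remCount_eq_sum (hlam : IsBipartition lam)
    (hN : ∀ a r, lam a r ≤ N ∧ (N ≤ r → lam a r = 0)) (i : ZMod e) :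
    (remCount e κ lam i : ℤ) = ∑ a : Fin 2, ∑ r ∈ Finset.range N,
      if lam a (r + 1) < lam a r then
        (if (lam a r : ZMod e) - r + κ a = i + 1 then 1 else 0) else 0 := by
  classical
  rw [remCount, ncard_eq_sum _ N]
  · refine Finset.sum_congr rfl fun a _ => Finset.sum_congr rfl fun r _ => ?_
    simp only [isRemovable_iff hlam, res]
    by_cases h : lam a (r + 1) < lam a r
    · rw [if_pos h]
      obtain ⟨m, hm⟩ : ∃ m, lam a r = m + 1 := ⟨lam a r - 1, by omega⟩
      have hmN := (hN a r).1
      rw [Finset.sum_eq_single m]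
      · refine if_congr ?_ rfl rfl
        rw [hm] at h ⊢
        simp only [true_and, h]
        push_cast
        constructor
        · intro h; rw [← h]; ring
        · intro h; linear_combination h
      · intro c _ hc
        rw [if_neg]
        rintro ⟨⟨h1, -⟩, -⟩
        omega
      · intro hc
        simp only [Finset.mem_range] at hc
        omega
    · rw [if_neg h]
      exact Finset.sum_eq_zero fun c _ => if_neg fun hc => h hc.1.2
  · rintro ⟨r, c, a⟩ ⟨hx, -⟩
    have hx' := (isRemovable_iff hlam r c a).1 hx
    have h := hN a r
    dsimp only
    omega

theorem addCount_eq_sum (hlam : IsBipartition lam)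
    (hN : ∀ a r, lam a r ≤ N ∧ (N ≤ r → lam a r = 0)) (i : ZMod e) :
    (addCount e κ lam i : ℤ) = ∑ a : Fin 2, ∑ r ∈ Finset.range (N + 1),
      if r = 0 ∨ lam a r < lam a (r - 1) then
        (if (lam a r : ZMod e) - r + κ a = i then 1 else 0) else 0 := by
  classical
  rw [addCount, ncard_eq_sum _ (N + 1)]
  · refine Finset.sum_congr rfl fun a _ => Finset.sum_congr rfl fun r _ => ?_
    simp only [isAddable_iff hlam, res]
    have hmN := (hN a r).1
    rw [Finset.sum_eq_single (lam a r)]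
    · by_cases h : r = 0 ∨ lam a r < lam a (r - 1) <;> simp [h]
    · intro c _ hc
      simp [hc]
    · intro hc
      simp only [Finset.mem_range] at hc
      omega
  · rintro ⟨r, c, a⟩ ⟨hx, -⟩
    have hx' := (isAddable_iff hlam r c a).1 hx
    have h := hN a r
    have h' := hN a (r - 1)
    dsimp only
    omega

end Counting

theorem sum_addable_sub_sum_removable {f : ℕ → ℕ} (hf : ∀ r, f (r + 1) ≤ f r) (g h : ℕ → ℤ)
    (hgh : ∀ r, f (r + 1) = f r → g (r + 1) = h r) (N : ℕ) :
    (∑ r ∈ Finset.range (N + 1), if r = 0 ∨ f r < f (r - 1) then g r else 0) -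
        (∑ r ∈ Finset.range N, if f (r + 1) < f r then h r else 0) =
      ∑ r ∈ Finset.range (N + 1), g r - ∑ r ∈ Finset.range N, h r := by
  induction N with
  | zero => simp
  | succ N ih =>
    rw [Finset.sum_range_succ _ (N + 1), Finset.sum_range_succ g (N + 1),
      Finset.sum_range_succ (fun r => if f (r + 1) < f r then h r else 0),
      Finset.sum_range_succ h]
    simp only [Nat.add_sub_cancel, Nat.succ_ne_zero, false_or]
    by_cases hlt : f (N + 1) < f N
    · rw [if_pos hlt, if_pos hlt]
      linarith
    · rw [if_neg hlt, if_neg hlt]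
      have := hgh N (le_antisymm (hf N) (not_lt.1 hlt))
      linarith

theorem row_count_sub {e : ℕ} (n : ℕ) (t i : ZMod e) :
    ((∑ c ∈ Finset.range n, if (c : ZMod e) + t = i + 1 then 1 else 0) : ℤ) -
        (∑ c ∈ Finset.range n, if (c : ZMod e) + t = i then 1 else 0) =
      (if t = i + 1 then 1 else 0) - (if (n : ZMod e) + t = i + 1 then 1 else 0) := by
  induction n with
  | zero => simp
  | succ n ih =>
    have h : ((n + 1 : ℕ) : ZMod e) + t = i + 1 ↔ (n : ZMod e) + t = i := by
      push_cast
      rw [add_right_comm, add_left_inj]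
    rw [Finset.sum_range_succ, Finset.sum_range_succ, if_congr h rfl rfl]
    linarith

/-- In one component, addable minus removable `i`-nodes in terms of residue counts. -/
theorem component_addable_sub_removable {e : ℕ} {f : ℕ → ℕ} (hf : ∀ r, f (r + 1) ≤ f r) {N : ℕ}
    (hN : f N = 0) (k i : ZMod e) :
    ((∑ r ∈ Finset.range (N + 1), if r = 0 ∨ f r < f (r - 1) then
        (if (f r : ZMod e) - r + k = i then 1 else 0) else 0) : ℤ) -
      (∑ r ∈ Finset.range N, if f (r + 1) < f r then
        (if (f r : ZMod e) - r + k = i + 1 then 1 else 0) else 0) =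
    (if k = i then 1 else 0)
      + ((∑ r ∈ Finset.range N, ∑ c ∈ Finset.range (f r),
          if (c : ZMod e) - r + k = i + 1 then 1 else 0)
        - (∑ r ∈ Finset.range N, ∑ c ∈ Finset.range (f r),
          if (c : ZMod e) - r + k = i then 1 else 0))
      - ((∑ r ∈ Finset.range N, ∑ c ∈ Finset.range (f r),
          if (c : ZMod e) - r + k = i then 1 else 0)
        - (∑ r ∈ Finset.range N, ∑ c ∈ Finset.range (f r),
          if (c : ZMod e) - r + k = i - 1 then 1 else 0)) := by
  rw [sum_addable_sub_sum_removable hf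
    (fun r => if (f r : ZMod e) - r + k = i then 1 else 0)
    (fun r => if (f r : ZMod e) - r + k = i + 1 then 1 else 0)]
  · have row (j : ZMod e) : ((∑ r ∈ Finset.range N, ∑ c ∈ Finset.range (f r),
          if (c : ZMod e) - r + k = j + 1 then 1 else 0) : ℤ)
        - (∑ r ∈ Finset.range N, ∑ c ∈ Finset.range (f r),
          if (c : ZMod e) - r + k = j then 1 else 0) =
        (∑ r ∈ Finset.range N, if -(r : ZMod e) + k = j + 1 then 1 else 0) -
        ∑ r ∈ Finset.range N, if (f r : ZMod e) - r + k = j + 1 then 1 else 0 := by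
      rw [← Finset.sum_sub_distrib, ← Finset.sum_sub_distrib]
      refine Finset.sum_congr rfl fun r _ => ?_
      have := row_count_sub (f r) (-(r : ZMod e) + k) j
      simpa only [← add_assoc, ← sub_eq_add_neg] using this
    have h2 := row (i - 1)
    rw [sub_add_cancel] at h2
    rw [row i, h2, Finset.sum_range_succ, hN]
    have tele := Finset.sum_range_succ'
      (fun r : ℕ => ((if -(r : ZMod e) + k = i then 1 else 0) : ℤ)) N
    rw [Finset.sum_range_succ] at tele
    have h3 : ∀ r : ℕ, -((r + 1 : ℕ) : ZMod e) + k = i ↔ -(r : ZMod e) + k = i + 1 := by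
      intro r
      push_cast
      constructor <;> intro h <;> linear_combination h
    simp only [h3, Nat.cast_zero, neg_zero, zero_add] at tele
    simp only [Nat.cast_zero, zero_sub]
    linarith
  · intro r hr
    rw [hr]
    refine if_congr ?_ rfl rfl
    push_cast
    constructor <;> intro h <;> linear_combination h

theorem delta_eq {e : ℕ} (κ : Fin 2 → ZMod e) {lam : Fin 2 → ℕ → ℕ} (hlam : IsBipartition lam)
    (i : ZMod e) :
    delta e κ lam i = 2 * (cnt e κ lam i : ℤ) - cnt e κ lam (i + 1) - cnt e κ lam (i - 1)
      - (if κ 0 = i then 1 else 0) - (if κ 1 = i then 1 else 0) := by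
  obtain ⟨N, hN⟩ := hlam.exists_bound
  have h0 := component_addable_sub_removable (hlam 0).1 ((hN 0 N).2 le_rfl) (κ 0) i
  have h1 := component_addable_sub_removable (hlam 1).1 ((hN 1 N).2 le_rfl) (κ 1) i
  rw [delta, remCount_eq_sum hlam hN, addCount_eq_sum hlam hN, cnt_eq_sum hN, cnt_eq_sum hN,
    cnt_eq_sum hN]
  simp only [Fin.sum_univ_two]
  linarith

theorem sum_range_eq_sum_zmod {e : ℕ} [NeZero e] (F : ZMod e → ℚ) :
    ∑ j ∈ Finset.range e, F (j : ZMod e) = ∑ j : ZMod e, F j := by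
  refine Finset.sum_nbij' (fun j : ℕ => (j : ZMod e)) ZMod.val (fun _ _ => Finset.mem_univ _)
    (fun j _ => Finset.mem_range.2 (ZMod.val_lt j)) (fun j hj => ?_) (fun j _ => ?_) fun _ _ => rfl
  · exact ZMod.val_cast_of_lt (Finset.mem_range.1 hj)
  · exact ZMod.natCast_zmod_val j

/-- The quadratic part of the weight after lowering one coordinate by `s`. -/
theorem sum_sq_sub_single {e : ℕ} (he : 2 ≤ e) [NeZero e] (c : ZMod e → ℚ) (i : ZMod e) (s : ℚ) :
    ∑ j : ZMod e, ((c j - if j = i then s else 0) - (c (j + 1) - if j + 1 = i then s else 0)) ^ 2 =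
      ∑ j : ZMod e, (c j - c (j + 1)) ^ 2
        - 2 * s * (2 * c i - c (i + 1) - c (i - 1)) + 2 * s ^ 2 := by
  have : Fact (1 < e) := ⟨he⟩
  have h : ∀ j : ZMod e,
      ((c j - if j = i then s else 0) - (c (j + 1) - if j + 1 = i then s else 0)) ^ 2 =
      (c j - c (j + 1)) ^ 2 + (if j = i then s ^ 2 - 2 * s * (c j - c (j + 1)) else 0) +
        (if j = i - 1 then s ^ 2 + 2 * s * (c j - c (j + 1)) else 0) := by
    intro j
    by_cases h1 : j = i
    · subst h1
      have h2 : j ≠ j - 1 := fun h => one_ne_zero (α := ZMod e) (by linear_combination h)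
      simp [h2]
      ring
    · by_cases h2 : j = i - 1
      · have h3 : j + 1 = i := by rw [h2, sub_add_cancel]
        rw [if_neg h1, if_pos h3, if_neg h1, if_pos h2, h3]
        ring
      · have h3 : j + 1 ≠ i := fun h => h2 (by rw [← h, add_sub_cancel_right])
        simp [h1, h2, h3]
  simp only [h, Finset.sum_add_distrib, Finset.sum_ite_eq', Finset.mem_univ, if_true,
    sub_add_cancel]
  ring

theorem exists_remove_all {e : ℕ} (κ : Fin 2 → ZMod e) {lam : Fin 2 → ℕ → ℕ}
    (hlam : IsBipartition lam) (i : ZMod e) :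
    ∃ mu, IsBipartition mu ∧
      Diagram mu = Diagram lam \ {x | IsRemovable lam x ∧ res e κ x = i} := by
  classical
  refine ⟨fun a r => if lam a (r + 1) < lam a r ∧ (lam a r : ZMod e) - 1 - r + κ a = i then
    lam a r - 1 else lam a r, fun a => ⟨fun r => ?_, ?_⟩, ?_⟩
  · have h := (hlam a).1 r
    dsimp only
    split_ifs <;> omega
  · obtain ⟨N, hN⟩ := (hlam a).2
    refine ⟨N, fun r hr => ?_⟩
    simp [hN r hr]
  · ext ⟨r, c, a⟩
    simp only [Diagram, Set.mem_ofPred_eq, Set.mem_sdiff, isRemovable_iff hlam, res]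
    by_cases hc : c + 1 = lam a r
    · simp only [← hc]
      push_cast
      simp only [add_sub_cancel_right]
      split_ifs with h <;> simp only [true_and] <;> grind
    · simp only [hc, false_and, not_false_eq_true, and_true]
      split_ifs <;> omega

/-- Removing all removable `i`-nodes lowers the weight by (removable) × (addable). -/
theorem wt_remove_all {e : ℕ} (he : 2 ≤ e) (κ : Fin 2 → ZMod e) {lam mu : Fin 2 → ℕ → ℕ}
    (hlam : IsBipartition lam) (i : ZMod e)
    (h : Diagram mu = Diagram lam \ {x | IsRemovable lam x ∧ res e κ x = i}) :
    wt e κ lam = wt e κ mu + remCount e κ lam i * addCount e κ lam i := by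
  have : NeZero e := ⟨by omega⟩
  have hcnt : ∀ j, (cnt e κ mu j : ℚ) =
      cnt e κ lam j - if j = i then (remCount e κ lam i : ℚ) else 0 := by
    intro j
    split_ifs with hj
    · subst hj
      have hsub : {x | IsRemovable lam x ∧ res e κ x = j} ⊆
          {x | x ∈ Diagram lam ∧ res e κ x = j} := fun x hx => ⟨hx.1.1, hx.2⟩
      have hfin : {x | x ∈ Diagram lam ∧ res e κ x = j}.Finite :=
        (finite_diagram hlam).subset fun x hx => hx.1
      have hset : {x | x ∈ Diagram mu ∧ res e κ x = j} =
          {x | x ∈ Diagram lam ∧ res e κ x = j} \ {x | IsRemovable lam x ∧ res e κ x = j} := by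
        ext x
        simp only [h, Set.mem_sdiff, Set.mem_ofPred_eq]
        tauto
      have := Set.ncard_sdiff_add_ncard_of_subset hsub hfin
      rw [← hset] at this
      rw [eq_sub_iff_add_eq]
      exact_mod_cast this
    · rw [sub_zero, cnt, cnt]
      congr 3
      ext x
      simp only [h, Set.mem_sdiff, Set.mem_ofPred_eq]
      constructor
      · tauto
      · rintro ⟨h1, h2⟩
        exact ⟨⟨h1, fun h3 => hj (h2.symm.trans h3.2)⟩, h2⟩
  have hd : (delta e κ lam i : ℚ) = _ := congrArg (Int.cast : ℤ → ℚ) (delta_eq κ hlam i)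
  rw [delta] at hd
  push_cast at hd
  have hsq := sum_sq_sub_single he (fun j => (cnt e κ lam j : ℚ)) i (remCount e κ lam i)
  rw [wt, wt, sum_range_eq_sum_zmod fun j => ((cnt e κ lam j : ℚ) - cnt e κ lam (j + 1)) ^ 2,
    sum_range_eq_sum_zmod fun j => ((cnt e κ mu j : ℚ) - cnt e κ mu (j + 1)) ^ 2]
  simp only [hcnt]
  rw [hsq]
  have hmul (p : Prop) [Decidable p] : (if p then (remCount e κ lam i : ℚ) else 0) =
      remCount e κ lam i * if p then 1 else 0 := by simp
  rw [hmul (κ 0 = i), hmul (κ 1 = i)]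
  linear_combination (remCount e κ lam i : ℚ) * hd

theorem exists_isRemovable {lam : Fin 2 → ℕ → ℕ} (hlam : IsBipartition lam)
    (h : (Diagram lam).Nonempty) : ∃ x, IsRemovable lam x := by
  obtain ⟨⟨r, c, a⟩, hx⟩ := h
  have hx' : c < lam a r := hx
  by_contra! hno
  have hconst : ∀ r, lam a r ≤ lam a (r + 1) := by
    intro r
    by_contra! hlt
    exact hno (r, lam a r - 1, a) ((isRemovable_iff hlam _ _ _).2 ⟨by omega, hlt⟩)
  obtain ⟨N, hN⟩ := (hlam a).2
  have h1 := monotone_nat_of_le_succ hconst (Nat.le_add_right r N)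
  have h2 := hN (r + N) (by omega)
  omega

theorem wt_nonneg {e : ℕ} (he : 2 ≤ e) (κ : Fin 2 → ZMod e) {lam : Fin 2 → ℕ → ℕ}
    (hlam : IsBipartition lam) : 0 ≤ wt e κ lam := by
  induction hn : (Diagram lam).ncard using Nat.strong_induction_on generalizing lam with
  | _ n ih =>
    rcases (Diagram lam).eq_empty_or_nonempty with hempty | hne
    · simp [wt, cnt, hempty]
    · obtain ⟨x, hx⟩ := exists_isRemovable hlam hne
      obtain ⟨mu, hmu, h⟩ := exists_remove_all κ hlam (res e κ x)
      have hlt : (Diagram mu).ncard < n := by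
        rw [← hn]
        refine Set.ncard_lt_ncard ?_ (finite_diagram hlam)
        rw [h]
        exact ⟨Set.sdiff_subset, fun hsub => (hsub hx.1).2 ⟨hx, rfl⟩⟩
      rw [wt_remove_all he κ hlam _ h]
      have := ih _ hlt hmu rfl
      positivity

theorem stmt17 (e : ℕ) (he : 2 ≤ e) (κ : Fin 2 → ZMod e) (lam : Fin 2 → ℕ → ℕ)
    (hlam : IsBipartition lam) (hwt : wt e κ lam = 3) (i : ZMod e) :
    (remCount e κ lam i : ℤ) ≤ max 1 (delta e κ lam i + 1) := by
  obtain ⟨mu, hmu, h⟩ := exists_remove_all κ hlam i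
  have hw := wt_remove_all he κ hlam i h
  have h0 := wt_nonneg he κ hmu
  have hle : remCount e κ lam i * addCount e κ lam i ≤ 3 := by
    have : (remCount e κ lam i * addCount e κ lam i : ℚ) ≤ 3 := by linarith
    exact_mod_cast this
  rw [delta]
  by_contra! hlt
  obtain ⟨h1, h2⟩ := max_lt_iff.1 hlt
  have := Nat.mul_le_mul (show 2 ≤ remCount e κ lam i by omega)
    (show 2 ≤ addCount e κ lam i by omega)
  omega

end Wt3
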